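/- If δ is a subtle cardinal, then the set of inaccessible δ-hyper-shrewd cardinals below δ is stationary in δ. -/

import Mathlib

universe u

open Cardinal

/-- Formulas of the language of set theory with an additional unary predicate
symbol `pred`; variables are indexed by natural numbers. -/
inductive SF : Type
  | mem : ℕ → ℕ → SF
  | eq : ℕ → ℕ → SF
  | pred : ℕ → SF
  | not : SF → SF
  | and : SF → SF → SF
  | ex : ℕ → SF → SF

/-- The free variables of a formula. -/
def SF.fv : SF → Set ℕ
  | .mem i j => {i, j}
  | .eq i j => {i, j}
  | .pred i => {i}
  | .not φ => φ.fv
  | .and φ ψ => φ.fv ∪ ψ.fv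
  | .ex k φ => φ.fv \ {k}

/-- Tarskian satisfaction of a formula in the structure whose carrier is the
class `S`, where the membership symbol is interpreted by the binary relation `E`
and the extra unary predicate symbol by the class `P`, under the valuation `v`. -/
def Sat (P : Set ZFSet.{u}) (E : ZFSet.{u} → ZFSet.{u} → Prop) (S : Set ZFSet.{u}) :
    SF → (ℕ → ZFSet.{u}) → Prop
  | .mem i j, v => E (v i) (v j)
  | .eq i j, v => v i = v j
  | .pred i, v => v i ∈ P
  | .not φ, v => ¬ Sat P E S φ v
  | .and φ ψ, v => Sat P E S φ v ∧ Sat P E S ψ v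
  | .ex k φ, v => ∃ x, x ∈ S ∧ Sat P E S φ (Function.update v k x)

/-- Satisfaction in the `∈`-structure with carrier `S`, the predicate symbol
being interpreted by the class `R`. -/
def SatIn (R : Set ZFSet.{u}) (S : Set ZFSet.{u}) (φ : SF) (v : ℕ → ZFSet.{u}) : Prop :=
  Sat R (· ∈ ·) S φ v

/-- Δ₀-formulas: built from atomic formulas by propositional connectives and
bounded existential quantification. -/
inductive IsDeltaZero : SF → Prop
  | mem (i j) : IsDeltaZero (.mem i j)
  | eq (i j) : IsDeltaZero (.eq i j)
  | pred (i) : IsDeltaZero (.pred i)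
  | not {φ} : IsDeltaZero φ → IsDeltaZero (.not φ)
  | and {φ ψ} : IsDeltaZero φ → IsDeltaZero ψ → IsDeltaZero (.and φ ψ)
  | bex {φ} (k j) : IsDeltaZero φ → IsDeltaZero (.ex k (.and (.mem k j) φ))

mutual
  /-- Σₙ-formulas of the Lévy hierarchy. -/
  inductive IsSigma : ℕ → SF → Prop
    | of_zero {φ} : IsDeltaZero φ → IsSigma 0 φ
    | of_pi {n φ} : IsPi n φ → IsSigma (n + 1) φ
    | ex {n φ} (k) : IsSigma (n + 1) φ → IsSigma (n + 1) (.ex k φ)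
  /-- Πₙ-formulas of the Lévy hierarchy. -/
  inductive IsPi : ℕ → SF → Prop
    | of_zero {φ} : IsDeltaZero φ → IsPi 0 φ
    | not {n φ} : IsSigma (n + 1) φ → IsPi (n + 1) (.not φ)
end

/-- The valuation sending `v₀` to `a`, `v₁` to `b` and all other variables to `∅`. -/
def val2 (a b : ZFSet.{u}) : ℕ → ZFSet.{u} := fun i => if i = 0 then a else if i = 1 then b else ∅

/-- `x` is a (von Neumann) ordinal. -/
def ZOrd (x : ZFSet.{u}) : Prop := x.IsTransitive ∧ ∀ y ∈ x, ZFSet.IsTransitive y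

/-- `κ` is a (von Neumann) cardinal. -/
def ZCard (κ : ZFSet.{u}) : Prop := ZOrd κ ∧ ∀ β ∈ κ, #β.toSet < #κ.toSet

/-- `κ` is an infinite cardinal. -/
def InfCard (κ : ZFSet.{u}) : Prop := ZCard κ ∧ ZFSet.omega ⊆ κ

/-- `κ` is an infinite regular cardinal: every cofinal subset of `κ` has
cardinality `κ`. -/
def ZRegular (κ : ZFSet.{u}) : Prop :=
  InfCard κ ∧ ∀ x : ZFSet.{u}, x ⊆ κ →
    (∀ β ∈ κ, ∃ γ ∈ x, β ∈ γ ∨ β = γ) → #x.toSet = #κ.toSet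

/-- `C` is a closed unbounded (class of) subset(s) of the ordinal `κ`. -/
def ZClub (C : Set ZFSet.{u}) (κ : ZFSet.{u}) : Prop :=
  (∀ γ ∈ C, γ ∈ κ) ∧ (∀ β ∈ κ, ∃ γ ∈ C, β ∈ γ) ∧
    (∀ β ∈ κ, (∃ γ, γ ∈ β) → (∀ γ ∈ β, ∃ δ ∈ C, γ ∈ δ ∧ δ ∈ β) → β ∈ C)

/-- `S` is stationary in `κ`: it meets every closed unbounded subset of `κ`. -/
def ZStationary (S : Set ZFSet.{u}) (κ : ZFSet.{u}) : Prop :=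
  ∀ C, ZClub C κ → ∃ γ ∈ C, γ ∈ S

/-- `H(θ)`: the class of all sets hereditarily of cardinality less than `θ`. -/
def HSet (θ : ZFSet.{u}) : Set ZFSet.{u} :=
  {x | ∃ t : ZFSet.{u}, t.IsTransitive ∧ x ⊆ t ∧ #t.toSet < #θ.toSet}

/-- `θ` is the cardinal successor `κ⁺` of `κ`. -/
def SuccCardOf (θ κ : ZFSet.{u}) : Prop :=
  ZCard θ ∧ κ ∈ θ ∧ ∀ μ, ZCard μ → κ ∈ μ → θ ⊆ μ

/-- `κ` is a weakly shrewd cardinal. -/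
def WeaklyShrewd (κ : ZFSet.{u}) : Prop :=
  InfCard κ ∧
    ∀ (φ : SF) (θ A : ZFSet.{u}), φ.fv ⊆ {0, 1} → ZCard θ → κ ∈ θ → A ⊆ κ →
      SatIn ∅ (HSet θ) φ (val2 A κ) →
      ∃ κ' θ' : ZFSet.{u}, ZCard κ' ∧ ZCard θ' ∧ κ' ∈ θ' ∧ κ' ∈ κ ∧
        SatIn ∅ (HSet θ') φ (val2 (A ∩ κ') κ')

/-- `j` is an elementary embedding of the `∈`-structure (with predicate `R`)
with carrier `X` into the one with carrier `Y`. -/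
def ElemEmbOn (R : Set ZFSet.{u}) (X Y : Set ZFSet.{u}) (j : ZFSet.{u} → ZFSet.{u}) : Prop :=
  (∀ x ∈ X, j x ∈ Y) ∧
    ∀ (φ : SF) (v : ℕ → ZFSet.{u}), (∀ i, v i ∈ X) →
      (SatIn R X φ v ↔ SatIn R Y φ (fun i => j (v i)))

/-- `X` is an elementary submodel of `Y` (as `∈`-structures with predicate `R`). -/
def ElemSub (R : Set ZFSet.{u}) (X Y : Set ZFSet.{u}) : Prop :=
  X ⊆ Y ∧ ∀ (φ : SF) (v : ℕ → ZFSet.{u}), (∀ i, v i ∈ X) → (SatIn R X φ v ↔ SatIn R Y φ v)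

/-- `X` is a Σₙ-elementary submodel of `Y`. -/
def SigmaElemSub (R : Set ZFSet.{u}) (n : ℕ) (X Y : Set ZFSet.{u}) : Prop :=
  X ⊆ Y ∧ ∀ (φ : SF), IsSigma n φ → ∀ (v : ℕ → ZFSet.{u}), (∀ i, v i ∈ X) →
    (SatIn R X φ v ↔ SatIn R Y φ v)

/-- `κ` is `δ`-hyper-shrewd: for all sufficiently large cardinals `θ > δ` and
all `z ∈ H(θ)`, there are cardinals `κ̄ < κ < δ < θ̄`, an elementary submodel
`X` of `H(θ̄)` and an elementary embedding `j : X → H(θ)` with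
`κ̄ ∪ {κ̄, δ} ⊆ X`, `j ↾ κ̄ = id`, `j(κ̄) = κ`, `j(δ) = δ` and `z ∈ ran(j)`. -/
def HyperShrewd (κ δ : ZFSet.{u}) : Prop :=
  ∃ θ₀ : ZFSet.{u}, ZCard θ₀ ∧
    ∀ θ : ZFSet.{u}, ZCard θ → δ ∈ θ → θ₀ ∈ θ → ∀ z ∈ HSet θ,
      ∃ (κ' θ' : ZFSet.{u}) (X : Set ZFSet.{u}) (j : ZFSet.{u} → ZFSet.{u}),
        ZCard κ' ∧ ZCard θ' ∧ κ' ∈ κ ∧ δ ∈ θ' ∧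
        ElemSub ∅ X (HSet θ') ∧ ElemEmbOn ∅ X (HSet θ) j ∧
        (∀ β ∈ κ', β ∈ X) ∧ κ' ∈ X ∧ δ ∈ X ∧
        (∀ β ∈ κ', j β = β) ∧ j κ' = κ ∧ j δ = δ ∧ ∃ x ∈ X, j x = z

/-- `δ` is a subtle cardinal. -/
def Subtle (δ : ZFSet.{u}) : Prop :=
  ZCard δ ∧
    ∀ d : ZFSet.{u} → ZFSet.{u}, (∀ α ∈ δ, d α ⊆ α) →
      ∀ C : Set ZFSet.{u}, ZClub C δ →
        ∃ α β : ZFSet.{u}, α ∈ C ∧ β ∈ C ∧ α ∈ β ∧ d α = d β ∩ α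

/-- `κ` is (strongly) inaccessible. -/
def Inacc (κ : ZFSet.{u}) : Prop :=
  ZRegular κ ∧ ZFSet.omega ∈ κ ∧
    ∀ β ∈ κ, (2 : Cardinal.{u + 1}) ^ #β.toSet < #κ.toSet

/-! ### Part 1: ordinals -/

def OClub (C : Set Ordinal.{u}) (δ : Ordinal.{u}) : Prop :=
  (∀ γ ∈ C, γ < δ) ∧ (∀ β < δ, ∃ γ ∈ C, β < γ) ∧
    ∀ β < δ, 0 < β → (∀ γ < β, ∃ ε ∈ C, γ < ε ∧ ε < β) → β ∈ C

def OSubtle (δ : Ordinal.{u}) : Prop :=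
  ∀ d : Ordinal.{u} → Set Ordinal.{u}, (∀ α < δ, d α ⊆ Set.Iio α) → ∀ C, OClub C δ →
    ∃ α ∈ C, ∃ β ∈ C, α < β ∧ d α = d β ∩ Set.Iio α

/-- there is a cofinal map from a smaller ordinal -/
def OSing (α : Ordinal.{u}) : Prop :=
  ∃ l < α, ∃ f : Ordinal.{u} → Ordinal.{u}, (∀ ξ < l, f ξ < α) ∧ ∀ β < α, ∃ ξ < l, β ≤ f ξ

theorem bdd_of_not_sing {α : Ordinal.{u}} (hs : ¬ OSing α)
    {ι : Type (u + 1)} (f : ι → Ordinal.{u}) (hf : ∀ i, f i < α)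
    (hι : #ι < Cardinal.lift.{u + 1} α.card) : ∃ β < α, ∀ i, f i < β := by
  obtain ⟨c, hcα, hc⟩ := Cardinal.lt_lift_iff.1 hι
  have hcard : #(Set.Iio c.ord) = #ι := by
    rw [Cardinal.mk_Iio_ordinal, Cardinal.card_ord, hc]
  obtain ⟨e⟩ := Cardinal.eq.1 hcard
  by_contra! hcon
  apply hs
  refine ⟨c.ord, (Cardinal.ord_lt_ord.2 hcα).trans_le (Cardinal.ord_card_le α), ?_⟩
  · refine ⟨fun ξ => if h : ξ < c.ord then f (e ⟨ξ, h⟩) else 0, ?_, ?_⟩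
    · intro ξ hξ
      simp only [hξ, dite_true]
      exact hf _
    · intro β hβ
      obtain ⟨i, hi⟩ := hcon β hβ
      refine ⟨(e.symm i).1, (e.symm i).2, ?_⟩
      have : (e.symm i).1 < c.ord := (e.symm i).2
      simp only [this, dite_true]
      have e2 : e ⟨(e.symm i).1, this⟩ = i := e.apply_symm_apply i
      rw [e2]
      exact hi

/-- tail is a club -/
theorem oclub_tail {δ : Ordinal.{u}} (hl : ∀ β < δ, Order.succ β < δ) (l : Ordinal.{u}) (h : l < δ) :
    OClub {α | l < α ∧ α < δ} δ := by
  refine ⟨fun γ h => h.2, ?_, ?_⟩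
  · intro β hβ
    refine ⟨Order.succ (max l β), ⟨?_, hl _ (max_lt h hβ)⟩, ?_⟩
    · exact Order.lt_succ_of_le (le_max_left _ _)
    · exact Order.lt_succ_of_le (le_max_right _ _)
  · intro β hβ h0 hh
    obtain ⟨ε, h1, h2, h3⟩ := hh 0 h0
    exact ⟨h1.1.trans h3, hβ⟩

theorem not_sing_of_subtle {δ : Ordinal.{u}} (hl : ∀ β < δ, Order.succ β < δ) (hδ : OSubtle δ) :
    ¬ OSing δ := by
  intro hs
  have key : ∃ l, l < δ ∧ ∃ f : Ordinal.{u} → Ordinal.{u}, (∀ ξ < l, f ξ < δ) ∧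
      ∀ β < δ, ∃ ξ < l, β ≤ f ξ := by
    obtain ⟨l, h1, h2⟩ := hs
    exact ⟨l, h1, h2⟩
  classical
  obtain ⟨l, ⟨hlδ, f, hf, hcof⟩, hmin⟩ := WellFounded.has_min (wellFounded_lt (α := Ordinal.{u}))
    {l | l < δ ∧ ∃ f : Ordinal.{u} → Ordinal.{u}, (∀ ξ < l, f ξ < δ) ∧
      ∀ β < δ, ∃ ξ < l, β ≤ f ξ} key
  let g : Ordinal.{u} → Ordinal.{u} := fun α => sInf {ξ | α ≤ f ξ ∧ ξ < l}
  have hg : ∀ α < δ, α ≤ f (g α) ∧ g α < l := by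
    intro α hα
    have : (sInf {ξ | α ≤ f ξ ∧ ξ < l}) ∈ {ξ | α ≤ f ξ ∧ ξ < l} := by
      apply csInf_mem
      obtain ⟨ξ, h1, h2⟩ := hcof α hα
      exact ⟨ξ, h2, h1⟩
    exact this
  have hgle : ∀ α ξ, α ≤ f ξ → ξ < l → g α ≤ ξ := fun α ξ h1 h2 => csInf_le' ⟨h1, h2⟩
  have hmono : ∀ α β, α ≤ β → β < δ → g α ≤ g β := by
    intro α β hαβ hβ
    exact hgle _ _ (hαβ.trans (hg β hβ).1) (hg β hβ).2
  -- g is unbounded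
  have hunb : ∀ β < δ, ∃ α < δ, g β < g α := by
    intro β hβ
    by_contra! hcon
    have hgl := (hg β hβ).2
    by_cases hsl : Order.succ (g β) < l
    · refine hmin (Order.succ (g β)) ⟨hsl.trans hlδ, f, ?_, ?_⟩ hsl
      · intro ξ hξ
        exact hf ξ (hξ.trans hsl)
      · intro γ hγ
        exact ⟨g γ, Order.lt_succ_of_le (hcon γ hγ), (hg γ hγ).1⟩
    · -- l = succ (g β); bounded by max
      have h1 : f (g β) < δ := hf _ hgl
      -- the ordinal `g β` is also enough unless ...
      refine hmin (g β) ⟨hgl.trans hlδ, fun ξ => f ξ, fun ξ hξ => hf ξ (hξ.trans hgl), ?_⟩ hgl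
      intro γ hγ
      have h2 := hl _ (max_lt hγ h1)
      have h3 := hcon _ h2
      refine ⟨g (Order.succ (max γ (f (g β)))), lt_of_le_of_ne h3 ?_, ?_⟩
      · intro h4
        have h5 := (hg _ h2).1
        rw [h4, Order.succ_le_iff] at h5
        exact absurd h5 (not_lt.2 (le_max_right _ _))
      · exact (le_max_left _ _).trans ((Order.le_succ _).trans (hg _ h2).1)
  let C : Set Ordinal.{u} := {α | α < δ ∧ l < α ∧ ∀ β < α, g β < g α}
  have hC : OClub C δ := by
    refine ⟨fun γ h => h.1, ?_, ?_⟩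
    · intro β hβ
      have hβ' : max β l < δ := max_lt hβ hlδ
      obtain ⟨α, ⟨hα, hα2⟩, hαmin⟩ := WellFounded.has_min (wellFounded_lt (α := Ordinal.{u}))
        {α | α < δ ∧ g (max β l) < g α} (hunb _ hβ')
      have hlt : max β l < α := by
        by_contra! hh
        exact absurd (hmono _ _ hh hβ') (not_le.2 hα2)
      refine ⟨α, ⟨hα, (le_max_right _ _).trans_lt hlt, ?_⟩, (le_max_left _ _).trans_lt hlt⟩
      intro γ hγ
      by_contra! hh
      exact hαmin γ ⟨hγ.trans hα, hα2.trans_le hh⟩ hγ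
    · intro β hβ h0 hh
      refine ⟨hβ, ?_, ?_⟩
      · obtain ⟨ε, h1, h2, h3⟩ := hh 0 h0
        exact h1.2.1.trans h3
      · intro γ hγ
        obtain ⟨ε, h1, h2, h3⟩ := hh γ hγ
        exact (h1.2.2 γ h2).trans_le (hmono _ _ h3.le hβ)
  obtain ⟨α, hα, β, hβ, hαβ, hd⟩ := hδ (fun α => {x | x = g α ∧ x < α})
    (fun α _ x hx => hx.2) C hC
  have h1 : g α < α := (hg α hα.1).2.trans hα.2.1
  have h2 : g α ∈ ({x | x = g α ∧ x < α} : Set Ordinal.{u}) := ⟨rfl, h1⟩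
  rw [hd] at h2
  exact (hβ.2.2 α hαβ).ne h2.1.1

theorem omega_lt_of_subtle {δ : Ordinal.{u}} (h0 : 0 < δ) (hl : ∀ β < δ, Order.succ β < δ)
    (hδ : OSubtle δ) : Ordinal.omega0 < δ := by
  by_contra! hcon
  obtain ⟨α, hα, β, hβ, hαβ, hd⟩ := hδ (fun α => {x | Order.succ x = α})
    (fun α _ x hx => by
      simp only [Set.mem_ofPred_eq] at hx
      rw [← hx]; exact Order.lt_succ x) _ (oclub_tail hl 0 h0)
  have hαω : α < Ordinal.omega0 := hα.2.trans_le hcon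
  obtain ⟨n, rfl⟩ := Ordinal.lt_omega0.1 hαω
  cases n with
  | zero => simpa using hα.1
  | succ n =>
    have h2 : (n : Ordinal.{u}) ∈ ({x | Order.succ x = ((n + 1 : ℕ) : Ordinal.{u})} : Set Ordinal.{u}) := by
      simp
    rw [hd] at h2
    have h3 : Order.succ (n : Ordinal.{u}) = β := h2.1
    rw [← h3] at hαβ
    simp at hαβ

theorem strongLimit_of_subtle {δ : Ordinal.{u}} (hl : ∀ β < δ, Order.succ β < δ)
    (hδ : OSubtle δ) (hcard : δ.card.ord = δ) : ∀ l < δ, ((2 : Cardinal.{u}) ^ l.card).ord < δ := by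
  intro l hlδ
  rw [← hcard]
  rw [Cardinal.ord_lt_ord]
  by_contra! hcon
  have h1 : #(Set.Iio δ) ≤ #(Set (Set.Iio l)) := by
    rw [Cardinal.mk_set, Cardinal.mk_Iio_ordinal, Cardinal.mk_Iio_ordinal]
    have := Cardinal.lift_le.{u + 1}.2 hcon
    simpa using this
  obtain ⟨g⟩ := h1
  obtain ⟨α, hα, β, hβ, hαβ, hd⟩ := hδ
    (fun α => {x | x < α ∧ ∃ (h : α < δ) (h' : x < l), ⟨x, h'⟩ ∈ g ⟨α, h⟩})
    (fun α _ x hx => hx.1) _ (oclub_tail hl l hlδ)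
  have : (⟨α, hα.2⟩ : Set.Iio δ) = ⟨β, hβ.2⟩ := by
    apply g.injective
    ext ⟨x, hx⟩
    have hx' : x < l := hx
    have := Set.ext_iff.1 hd x
    simp only [Set.mem_ofPred_eq, Set.mem_inter_iff, Set.mem_Iio] at this
    have ha := hx'.trans hα.1
    have hb := hx'.trans hβ.1
    have e1 : α < δ := hα.2
    have e2 : β < δ := hβ.2
    simpa [ha, hb, e1, e2, hx'] using this
  exact hαβ.ne (congrArg Subtype.val this)

/-- Closure points of a function form a club. -/
theorem oclub_closure {δ : Ordinal.{u}} (hs : ¬ OSing δ) (hω : Ordinal.omega0 < δ)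
    (hcard : δ.card.ord = δ)
    (F : Ordinal.{u} → Ordinal.{u}) (hF : ∀ ξ < δ, F ξ < δ) (hF' : ∀ ξ < δ, ξ < F ξ) :
    OClub {α | α < δ ∧ 0 < α ∧ ∀ ξ < α, F ξ < α} δ := by
  refine ⟨fun γ h => h.1, ?_, ?_⟩
  · intro β hβ
    have step : ∀ β : Set.Iio δ, ∃ γ : Set.Iio δ, β.1 < γ.1 ∧ ∀ ξ ≤ β.1, F ξ < γ.1 := by
      rintro ⟨β, hβ⟩
      have hβ' : β < δ := hβ
      obtain ⟨γ, h1, h2⟩ := bdd_of_not_sing hs (ι := Set.Iio (Order.succ β)) (fun ξ => F ξ.1)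
        (fun ξ => hF _ ((Order.lt_succ_iff.1 ξ.2).trans_lt hβ)) (by
          rw [Cardinal.mk_Iio_ordinal, Cardinal.lift_lt, ← Cardinal.lt_ord, hcard]
          have hlim : Order.IsSuccLimit δ := by
            rw [← hcard]
            apply Cardinal.isSuccLimit_ord
            rw [← Ordinal.card_omega0]
            exact Ordinal.card_le_card hω.le
          exact hlim.succ_lt hβ)
      refine ⟨⟨γ, h1⟩, ?_, ?_⟩
      · exact (hF' β hβ).trans (h2 ⟨β, Order.lt_succ β⟩)
      · intro ξ hξ
        exact h2 ⟨ξ, Order.lt_succ_of_le hξ⟩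
    choose G hG1 hG2 using step
    let s : ℕ → Set.Iio δ := fun n => G^[n] ⟨β, hβ⟩
    have hs1 : ∀ n, s (n + 1) = G (s n) := fun n => Function.iterate_succ_apply' _ _ _
    obtain ⟨γ, h1, h2⟩ := bdd_of_not_sing hs (ι := ULift ℕ) (fun n => (s n.down).1)
      (fun n => (s n.down).2) (by
        have : ℵ₀ < δ.card := by
          rw [← Cardinal.ord_lt_ord, hcard, Cardinal.ord_aleph0]; exact hω
        simpa using Cardinal.lift_lt.{u, u+1}.2 this)
    let S : Set Ordinal.{u} := {γ | ∀ n, (s n).1 < γ}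
    have hSne : S.Nonempty := ⟨γ, fun n => h2 ⟨n⟩⟩
    have hmem : sInf S ∈ S := csInf_mem hSne
    have hle : sInf S ≤ γ := csInf_le' (fun n => h2 ⟨n⟩)
    have hβlt : β < sInf S := hmem 0
    refine ⟨sInf S, ⟨hle.trans_lt h1, zero_le.trans_lt hβlt, ?_⟩, hβlt⟩
    intro ξ hξ
    have : ξ ∉ S := fun h => absurd (csInf_le' h) (not_le.2 hξ)
    simp only [S, Set.mem_ofPred_eq, not_forall, not_lt] at this
    obtain ⟨n, hn⟩ := this
    have := hG2 (s n) ξ hn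
    rw [← hs1] at this
    exact this.trans (hmem (n + 1))
  · intro β hβ h0 hh
    refine ⟨hβ, h0, ?_⟩
    intro ξ hξ
    obtain ⟨ε, h1, h2, h3⟩ := hh ξ hξ
    exact (h1.2.2 ξ h2).trans h3

/-! ### Part 2: formulas -/

def SF.code : SF → ℕ
  | .mem i j => 6 * Nat.pair i j
  | .eq i j => 6 * Nat.pair i j + 1
  | .pred i => 6 * i + 2
  | .not φ => 6 * φ.code + 3
  | .and φ ψ => 6 * Nat.pair φ.code ψ.code + 4
  | .ex k φ => 6 * Nat.pair k φ.code + 5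

theorem SF.code_inj : ∀ φ ψ : SF, φ.code = ψ.code → φ = ψ := by
  intro φ
  induction φ with
  | mem i j =>
    intro ψ h
    cases ψ <;> simp only [SF.code] at h <;> try omega
    rename_i a b
    have := Nat.pair_eq_pair.1 (show Nat.pair i j = Nat.pair a b by omega)
    rw [this.1, this.2]
  | eq i j =>
    intro ψ h
    cases ψ <;> simp only [SF.code] at h <;> try omega
    rename_i a b
    have := Nat.pair_eq_pair.1 (show Nat.pair i j = Nat.pair a b by omega)
    rw [this.1, this.2]
  | pred i =>
    intro ψ h
    cases ψ <;> simp only [SF.code] at h <;> try omega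
    congr 1; omega
  | not φ ih =>
    intro ψ h
    cases ψ <;> simp only [SF.code] at h <;> try omega
    congr 1; apply ih; omega
  | and φ χ ih1 ih2 =>
    intro ψ h
    cases ψ <;> simp only [SF.code] at h <;> try omega
    rename_i a b
    have := Nat.pair_eq_pair.1 (show Nat.pair φ.code χ.code = Nat.pair a.code b.code by omega)
    rw [ih1 _ this.1, ih2 _ this.2]
  | ex k φ ih =>
    intro ψ h
    cases ψ <;> simp only [SF.code] at h <;> try omega
    rename_i a b
    have := Nat.pair_eq_pair.1 (show Nat.pair k φ.code = Nat.pair a b.code by omega)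
    rw [this.1, ih _ this.2]

theorem SF.countable : Countable SF := ⟨SF.code, fun _ _ h => SF.code_inj _ _ h⟩

theorem sat_local (φ : SF) : ∃ N : ℕ, ∀ (P : Set ZFSet.{u}) (E : ZFSet.{u} → ZFSet.{u} → Prop)
    (S : Set ZFSet.{u}) (v w : ℕ → ZFSet.{u}), (∀ i < N, v i = w i) →
    (Sat P E S φ v ↔ Sat P E S φ w) := by
  induction φ with
  | mem i j =>
    refine ⟨i + j + 1, fun P E S v w h => ?_⟩
    simp only [Sat]
    rw [h i (by omega), h j (by omega)]
  | eq i j =>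
    refine ⟨i + j + 1, fun P E S v w h => ?_⟩
    simp only [Sat]
    rw [h i (by omega), h j (by omega)]
  | pred i =>
    refine ⟨i + 1, fun P E S v w h => ?_⟩
    simp only [Sat]
    rw [h i (by omega)]
  | not φ ih =>
    obtain ⟨N, hN⟩ := ih
    refine ⟨N, fun P E S v w h => ?_⟩
    simp only [Sat]
    rw [hN P E S v w h]
  | and φ ψ ih1 ih2 =>
    obtain ⟨N, hN⟩ := ih1
    obtain ⟨M, hM⟩ := ih2
    refine ⟨N + M, fun P E S v w h => ?_⟩
    simp only [Sat]
    rw [hN P E S v w (fun i hi => h i (by omega)), hM P E S v w (fun i hi => h i (by omega))]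
  | ex k φ ih =>
    obtain ⟨N, hN⟩ := ih
    refine ⟨N, fun P E S v w h => ?_⟩
    simp only [Sat]
    refine exists_congr fun x => and_congr_right fun _ => ?_
    apply hN
    intro i hi
    by_cases hik : i = k
    · subst hik; simp
    · simp [Function.update_of_ne hik, h i hi]

theorem mk_coded_le {c : Cardinal.{u + 1}} (hc : ℵ₀ ≤ c) (A : Type (u + 1)) (hA : #A ≤ c) :
    #(SF × List (ℕ × A)) ≤ c := by
  have h0 := SF.countable
  have h1 : #(ℕ × A) ≤ c := by
    rw [Cardinal.mk_prod]
    refine Cardinal.mul_le_of_le hc ?_ ?_ <;> simpa using by assumption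
  have h2 : #(List (ℕ × A)) ≤ c := (Cardinal.mk_list_le_max _).trans (max_le hc h1)
  rw [Cardinal.mk_prod]
  refine Cardinal.mul_le_of_le hc ?_ ?_
  · have : #SF ≤ ℵ₀ := Cardinal.mk_le_aleph0
    have := Cardinal.lift_le.{u+1}.2 this
    rw [Cardinal.lift_aleph0] at this
    exact this.trans hc
  · simpa using h2

/-- Downward Löwenheim–Skolem. -/
theorem exists_elemSub (S A : Set ZFSet.{u}) (a₀ : ZFSet.{u}) (ha₀ : a₀ ∈ A) (hAS : A ⊆ S)
    (c : Cardinal.{u + 1}) (hc : ℵ₀ ≤ c) (hA : #A ≤ c) :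
    ∃ X : Set ZFSet.{u}, A ⊆ X ∧ #X ≤ c ∧ ElemSub ∅ X S := by
  classical
  have hw : ∀ (φ : SF) (l : List (ℕ × ZFSet.{u})) , ∃ x, x ∈ S ∧ ∀ k, l.head?.map Prod.fst = some k →
      ((∃ x ∈ S, SatIn ∅ S φ (Function.update (fun n => (l.getD n (0, a₀)).2) k x)) →
        SatIn ∅ S φ (Function.update (fun n => (l.getD n (0, a₀)).2) k x)) := by
    intro φ l
    cases l with
    | nil => exact ⟨a₀, hAS ha₀, fun k hk => by simp at hk⟩
    | cons p l =>
      by_cases h : (∃ x ∈ S, SatIn ∅ S φ (Function.update (fun n => ((p :: l).getD n (0, a₀)).2) p.1 x))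
      · obtain ⟨x, hx, hs⟩ := h
        refine ⟨x, hx, fun k hk _ => ?_⟩
        have : p.1 = k := by simpa using hk
        rw [← this]; exact hs
      · refine ⟨a₀, hAS ha₀, fun k hk hh => ?_⟩
        have : p.1 = k := by simpa using hk
        rw [← this] at hh; exact absurd hh h
  choose w hwS hw using hw
  let step : Set ZFSet.{u} → Set ZFSet.{u} := fun Y =>
    Y ∪ Set.range (fun q : SF × List (ℕ × Y) => w q.1 (q.2.map (fun p => (p.1, p.2.1))))
  let X : ℕ → Set ZFSet.{u} := fun n => step^[n] A
  have hX1 : ∀ n, X (n + 1) = step (X n) := fun n => Function.iterate_succ_apply' _ _ _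
  have hXS : ∀ n, X n ⊆ S := by
    intro n
    induction n with
    | zero => exact hAS
    | succ n ih =>
      rw [hX1]
      rintro x (hx | ⟨q, rfl⟩)
      · exact ih hx
      · exact hwS _ _
  have hXc : ∀ n, #(X n) ≤ c := by
    intro n
    induction n with
    | zero => exact hA
    | succ n ih =>
      rw [hX1]
      refine (Cardinal.mk_union_le _ _).trans (Cardinal.add_le_of_le hc ih ?_)
      exact Cardinal.mk_range_le.trans (mk_coded_le hc _ ih)
  have hmono : Monotone X := by
    apply monotone_nat_of_le_succ
    intro n
    rw [hX1]
    exact Set.subset_union_left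
  have hsub : (⋃ n, X n) ⊆ S := Set.iUnion_subset hXS
  refine ⟨⋃ n, X n, ?_, ?_, hsub, ?_⟩
  · exact Set.subset_iUnion X 0
  · have h1 := Cardinal.mk_iUnion_le_sum_mk_lift (f := X)
    rw [Cardinal.lift_id'.{0, u + 1}] at h1
    refine h1.trans ?_
    refine (Cardinal.sum_le_sum _ (fun _ => c) hXc).trans ?_
    rw [Cardinal.sum_const]
    refine Cardinal.mul_le_of_le hc ?_ ?_ <;> simp [hc]
  · intro φ
    induction φ with
    | mem i j => intro v hv; simp only [SatIn, Sat]
    | eq i j => intro v hv; simp only [SatIn, Sat]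
    | pred i => intro v hv; simp only [SatIn, Sat]
    | not φ ih =>
      intro v hv
      have := ih v hv
      simp only [SatIn, Sat] at this ⊢
      rw [this]
    | and φ ψ ih1 ih2 =>
      intro v hv
      have h1 := ih1 v hv
      have h2 := ih2 v hv
      simp only [SatIn, Sat] at h1 h2 ⊢
      rw [h1, h2]
    | ex k φ ih =>
      intro v hv
      have hupd : ∀ x ∈ ⋃ n, X n, ∀ i, Function.update v k x i ∈ ⋃ n, X n := by
        intro x hx i
        by_cases hik : i = k
        · subst hik; simpa using hx
        · rw [Function.update_of_ne hik]; exact hv i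
      constructor
      · rintro ⟨x, hx, h⟩
        exact ⟨x, hsub hx, (ih _ (hupd x hx)).1 h⟩
      · rintro ⟨x, hx, h⟩
        obtain ⟨N, hN⟩ := sat_local.{u} φ
        -- find a stage
        have hstage : ∀ M : ℕ, ∃ n, ∀ i < M, v i ∈ X n := by
          intro M
          induction M with
          | zero => exact ⟨0, fun i hi => by omega⟩
          | succ M ihM =>
            obtain ⟨n, hn⟩ := ihM
            obtain ⟨m, hm⟩ := Set.mem_iUnion.1 (hv M)
            refine ⟨max n m, fun i hi => ?_⟩
            by_cases hiM : i = M
            · subst hiM; exact hmono (le_max_right _ _) hm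
            · exact hmono (le_max_left _ _) (hn i (by omega))
        obtain ⟨n, hn⟩ := hstage (N + 1)
        let l : List (ℕ × X n) := List.ofFn (fun i : Fin (N + 1) => (k, ⟨v i.1, hn i.1 i.2⟩))
        let l' := l.map (fun p => (p.1, p.2.1))
        have hl' : l' = List.ofFn (fun i : Fin (N + 1) => (k, v i.1)) := by
          simp only [l', l, List.map_ofFn]; rfl
        have hwX : w φ l' ∈ ⋃ n, X n := by
          refine Set.mem_iUnion.2 ⟨n + 1, ?_⟩
          rw [hX1]
          exact Or.inr ⟨(φ, l), rfl⟩
        have hget : ∀ i < N, (l'.getD i (0, a₀)).2 = v i := by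
          intro i hi
          have hlen : i < l'.length := by rw [hl']; simp; omega
          rw [List.getD_eq_getElem _ _ hlen]
          simp only [hl', List.getElem_ofFn]
        have hagree : ∀ x, ∀ i < N, Function.update v k x i =
            Function.update (fun n => (l'.getD n (0, a₀)).2) k x i := by
          intro x i hi
          by_cases hik : i = k
          · subst hik; simp
          · rw [Function.update_of_ne hik, Function.update_of_ne hik, hget i hi]
        refine ⟨w φ l', hwX, (ih _ (hupd _ hwX)).2 ?_⟩
        refine (hN _ _ _ _ _ (hagree _)).2 ?_
        refine hw φ l' k ?_ ⟨x, hx, (hN _ _ _ _ _ (hagree _)).1 h⟩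
        rw [hl']
        simp

/-! ### Part 3: coded subtlety -/

theorem coded_subtle {δ : Ordinal.{u}} (h0 : 0 < δ) (hl : ∀ β < δ, Order.succ β < δ)
    (hcard : δ.card.ord = δ) (hδ : OSubtle δ) (C : Set Ordinal.{u}) (hC : OClub C δ)
    (D : Ordinal.{u} → Set (SF × List (ℕ × Ordinal.{u}))) :
    ∃ α ∈ C, ∃ β ∈ C, α < β ∧ Ordinal.omega0 < α ∧
      (∀ ξ < α, ((2 : Cardinal.{u}) ^ ξ.card).ord < α) ∧
      (∀ ξ < β, ((2 : Cardinal.{u}) ^ ξ.card).ord < β) ∧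
      ∀ φ l, (∀ p ∈ l, p.2 < α) → ((φ, l) ∈ D α ↔ (φ, l) ∈ D β) := by
  have hω := omega_lt_of_subtle h0 hl hδ
  have hs := not_sing_of_subtle hl hδ
  have hsl := strongLimit_of_subtle hl hδ hcard
  have hℵ : ℵ₀ < δ.card := by
    rw [← Cardinal.ord_lt_ord, hcard, Cardinal.ord_aleph0]; exact hω
  have hcd : #(SF × List (ℕ × Set.Iio δ)) ≤ #(Set.Iio δ) := by
    apply mk_coded_le _ _ le_rfl
    rw [Cardinal.mk_Iio_ordinal, Cardinal.aleph0_le_lift]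
    exact hℵ.le
  obtain ⟨e⟩ := hcd
  have hF : ∀ ξ, ∃ η, ξ < δ → η < δ ∧ ξ < η ∧ Ordinal.omega0 < η ∧
      ((2 : Cardinal.{u}) ^ ξ.card).ord < η ∧ (∃ γ ∈ C, ξ < γ ∧ γ < η) ∧
      ∀ φ l, (∀ p ∈ l, (p.2 : Ordinal.{u}) < ξ) → (e (φ, l)).1 < η := by
    intro ξ
    by_cases hξ : ξ < δ
    swap
    · exact ⟨0, fun h => absurd h hξ⟩
    obtain ⟨γ, hγC, hγ⟩ := hC.2.1 ξ hξ
    obtain ⟨ν, hν, hν'⟩ := bdd_of_not_sing hs (ι := SF × List (ℕ × Set.Iio ξ))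
      (fun q => (e (q.1, q.2.map (fun p => (p.1, ⟨p.2.1, lt_trans p.2.2 hξ⟩)))).1)
      (fun q => (e _).2) (by
        have : #(SF × List (ℕ × Set.Iio ξ)) ≤ Cardinal.lift.{u + 1} (max ℵ₀ ξ.card) := by
          apply mk_coded_le
          · rw [Cardinal.aleph0_le_lift]; exact le_max_left _ _
          · rw [Cardinal.mk_Iio_ordinal, Cardinal.lift_le]; exact le_max_right _ _
        refine this.trans_lt ?_
        rw [Cardinal.lift_lt]
        refine max_lt hℵ ?_
        rw [← Cardinal.lt_ord, hcard]; exact hξ)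
    have hm : max (max (max ξ Ordinal.omega0) (max ((2 : Cardinal.{u}) ^ ξ.card).ord γ)) ν < δ :=
      max_lt (max_lt (max_lt hξ hω) (max_lt (hsl ξ hξ) (hC.1 γ hγC))) hν
    refine ⟨_, fun _ => ⟨hl _ hm, ?_, ?_, ?_, ⟨γ, hγC, hγ, ?_⟩, ?_⟩⟩
    · apply Order.lt_succ_of_le; simp
    · apply Order.lt_succ_of_le; simp
    · apply Order.lt_succ_of_le; simp
    · apply Order.lt_succ_of_le; simp
    · intro φ l hlξ
      refine lt_of_lt_of_le ?_ ((le_max_right _ _).trans (Order.le_succ _))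
      have hx : l = (l.pmap (fun p (hp : (p.2 : Ordinal.{u}) < ξ) =>
          ((p.1, ⟨p.2.1, hp⟩) : ℕ × Set.Iio ξ)) hlξ).map
            (fun p => (p.1, ⟨p.2.1, lt_trans p.2.2 hξ⟩)) := by
        rw [List.map_pmap]
        exact ((List.pmap_eq_map (f := id) hlξ).trans (List.map_id l)).symm
      rw [hx]
      exact hν' (φ, _)
  choose F hF using hF
  have hcl := oclub_closure hs hω hcard F (fun ξ hξ => (hF ξ hξ).1) (fun ξ hξ => (hF ξ hξ).2.1)
  -- properties of closure points
  have hCin : ∀ α, α < δ → 0 < α → (∀ ξ < α, F ξ < α) → α ∈ C := by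
    intro α h1 h2 h3
    refine hC.2.2 α h1 h2 ?_
    intro γ hγ
    obtain ⟨ε, h4, h5, h6⟩ := (hF γ (hγ.trans h1)).2.2.2.2.1
    exact ⟨ε, h4, h5, h6.trans (h3 γ hγ)⟩
  have hesub : ∀ α, α < δ → 0 < α → (∀ ξ < α, F ξ < α) → ∀ φ l,
      (∀ p ∈ l, (p.2 : Ordinal.{u}) < α) → (e (φ, l)).1 < α := by
    intro α h1 h2 h3 φ l h4
    have : ∃ ξ < α, ∀ p ∈ l, (p.2 : Ordinal.{u}) < ξ := by
      induction l with
      | nil => exact ⟨0, h2, by simp⟩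
      | cons p l ih =>
        obtain ⟨ξ, hξ, h5⟩ := ih (fun q hq => h4 q (List.mem_cons_of_mem _ hq))
        refine ⟨Order.succ (max ξ p.2), ?_, ?_⟩
        · have h6 : max ξ p.2.1 < α := max_lt hξ (h4 p (by simp))
          exact (Order.succ_le_of_lt ((hF _ (h6.trans h1)).2.1)).trans_lt (h3 _ h6)
        · intro q hq
          rcases List.mem_cons.1 hq with rfl | hq
          · exact Order.lt_succ_of_le (le_max_right _ _)
          · exact (h5 q hq).trans_le ((le_max_left _ _).trans (Order.le_succ _))
    obtain ⟨ξ, hξ, h5⟩ := this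
    exact ((hF ξ (hξ.trans h1)).2.2.2.2.2 φ l h5).trans (h3 ξ hξ)
  obtain ⟨α, ⟨a1, a2, a3⟩, β, ⟨b1, b2, b3⟩, hαβ, hd⟩ := hδ
    (fun α => {x | x < α ∧ ∃ φ l, (e (φ, l)).1 = x ∧
      (φ, l.map (fun p => (p.1, (p.2 : Ordinal.{u})))) ∈ D α}) (fun α _ x hx => hx.1) _ hcl
  refine ⟨α, hCin α a1 a2 a3, β, hCin β b1 b2 b3, hαβ, ?_, ?_, ?_, ?_⟩
  · exact (hF 0 h0).2.2.1.trans (a3 0 a2)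
  · exact fun ξ hξ => (hF ξ (hξ.trans a1)).2.2.2.1.trans (a3 ξ hξ)
  · exact fun ξ hξ => (hF ξ (hξ.trans b1)).2.2.2.1.trans (b3 ξ hξ)
  · intro φ l hlα
    let l₁ : List (ℕ × Set.Iio δ) := l.pmap (fun p (hp : p.2 < α) => (p.1, ⟨p.2, hp.trans a1⟩)) hlα
    have hl₁ : l₁.map (fun p => (p.1, (p.2 : Ordinal.{u}))) = l := by
      simp only [l₁, List.map_pmap]
      simp
    have hl₁α : ∀ p ∈ l₁, (p.2 : Ordinal.{u}) < α := by
      intro p hp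
      simp only [l₁, List.mem_pmap] at hp
      obtain ⟨q, hq, rfl⟩ := hp
      exact hlα q hq
    have h1 : (e (φ, l₁)).1 < α := hesub α a1 a2 a3 φ l₁ hl₁α
    have gen : ∀ γ, (e (φ, l₁)).1 < γ → ((e (φ, l₁)).1 ∈ ({x | x < γ ∧ ∃ φ l, (e (φ, l)).1 = x ∧
      (φ, l.map (fun p => (p.1, (p.2 : Ordinal.{u})))) ∈ D γ} : Set Ordinal.{u}) ↔ (φ, l) ∈ D γ) := by
      intro γ hγ
      constructor
      · rintro ⟨_, φ', l', he, hD⟩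
        have := e.injective (Subtype.ext he)
        obtain ⟨rfl, rfl⟩ := Prod.mk.inj this
        rwa [hl₁] at hD
      · intro hD
        exact ⟨hγ, φ, l₁, rfl, by rwa [hl₁]⟩
    rw [← gen α h1, ← gen β (h1.trans hαβ), hd]
    exact ⟨fun h => h.1, fun h => ⟨h, h1⟩⟩

/-! ### Part 4: transfer to `ZFSet` -/

theorem mk_toSet (x : ZFSet.{u}) : #x.toSet = Cardinal.lift.{u + 1} x.card :=
  ZFSet.cardinalMk_coe_sort

theorem mk_toSet_ord (o : Ordinal.{u}) : #o.toZFSet.toSet = Cardinal.lift.{u + 1} o.card := by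
  rw [mk_toSet, Ordinal.card_toZFSet]

theorem zord_iff (x : ZFSet.{u}) : ZOrd x ↔ x.IsOrdinal :=
  ZFSet.isOrdinal_iff_forall_mem_isTransitive.symm

theorem mk_ofNat_eq (n : ℕ) : ZFSet.mk (PSet.ofNat.{u} n) = (n : Ordinal.{u}).toZFSet := by
  induction n with
  | zero => simp [PSet.ofNat]; rfl
  | succ n ih =>
    rw [Nat.cast_succ, Ordinal.toZFSet_add_one, ← ih]
    rfl

theorem omega_eq : ZFSet.omega.{u} = Ordinal.omega0.toZFSet := by
  ext x
  rw [Ordinal.mem_toZFSet_iff]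
  constructor
  · induction x using Quotient.inductionOn with
    | h x =>
      rintro ⟨⟨n⟩, h⟩
      refine ⟨n, Ordinal.nat_lt_omega0 n, ?_⟩
      rw [← mk_ofNat_eq]
      exact (ZFSet.sound h).symm
  · rintro ⟨a, ha, rfl⟩
    obtain ⟨n, rfl⟩ := Ordinal.lt_omega0.1 ha
    rw [← mk_ofNat_eq]
    exact ⟨⟨n⟩, PSet.Equiv.refl _⟩

theorem two_pow_lt {β : Ordinal.{u}} (h : ∀ ξ < β, ((2 : Cardinal.{u}) ^ ξ.card).ord < β) :
    ∀ ξ < β, (2 : Cardinal.{u}) ^ ξ.card < β.card := by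
  intro ξ hξ
  have h2 := h _ (h ξ hξ)
  rw [Cardinal.card_ord] at h2
  have h3 := Ordinal.card_le_card h2.le
  rw [Cardinal.card_ord] at h3
  exact (Cardinal.cantor _).trans_le h3

theorem zcard_of {β : Ordinal.{u}} (h : ∀ ξ < β, ((2 : Cardinal.{u}) ^ ξ.card).ord < β) :
    ZCard β.toZFSet := by
  refine ⟨(zord_iff _).2 (ZFSet.isOrdinal_toZFSet _), ?_⟩
  intro x hx
  obtain ⟨ξ, hξ, rfl⟩ := Ordinal.mem_toZFSet_iff.1 hx
  rw [mk_toSet_ord, mk_toSet_ord, Cardinal.lift_lt]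
  exact (Cardinal.cantor _).trans (two_pow_lt h ξ hξ)

theorem inacc_of {β : Ordinal.{u}} (h : ∀ ξ < β, ((2 : Cardinal.{u}) ^ ξ.card).ord < β)
    (hω : Ordinal.omega0 < β) (hs : ¬ OSing β) : Inacc β.toZFSet := by
  refine ⟨⟨⟨zcard_of h, ?_⟩, ?_⟩, ?_, ?_⟩
  · rw [omega_eq, Ordinal.toZFSet_subset_toZFSet_iff]
    exact hω.le
  · intro x hx hcof
    have hle : #x.toSet ≤ #β.toZFSet.toSet := by
      rw [mk_toSet, mk_toSet, Cardinal.lift_le]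
      exact ZFSet.card_mono hx
    by_contra hne
    have hlt := lt_of_le_of_ne hle hne
    rw [mk_toSet_ord] at hlt
    obtain ⟨γ, hγ, hb⟩ := bdd_of_not_sing hs (ι := x.toSet) (fun i => i.1.rank) (by
      rintro ⟨i, hi⟩
      obtain ⟨ξ, hξ, hi'⟩ := Ordinal.mem_toZFSet_iff.1 (hx hi)
      simp only [← hi', Ordinal.rank_toZFSet]
      exact hξ) hlt
    obtain ⟨y, hy, h1⟩ := hcof γ.toZFSet (Ordinal.toZFSet_mem_toZFSet_iff.2 hγ)
    have h2 : y.rank < γ := hb ⟨y, hy⟩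
    rcases h1 with h1 | h1
    · have := ZFSet.rank_lt_of_mem h1
      rw [Ordinal.rank_toZFSet] at this
      exact absurd h2 (not_lt.2 this.le)
    · rw [← h1, Ordinal.rank_toZFSet] at h2
      exact lt_irrefl _ h2
  · rw [omega_eq, Ordinal.toZFSet_mem_toZFSet_iff]
    exact hω
  · intro x hx
    obtain ⟨ξ, hξ, rfl⟩ := Ordinal.mem_toZFSet_iff.1 hx
    rw [mk_toSet_ord, mk_toSet_ord]
    have := Cardinal.lift_lt.{u, u + 1}.2 (two_pow_lt h ξ hξ)
    simpa using this

theorem mem_HSet_of {θ x : ZFSet.{u}} (hθ : ZCard θ) (hx : x ∈ θ) : x ∈ HSet θ :=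
  ⟨x, hθ.1.2 x hx, fun _ h => h, hθ.2 x hx⟩

theorem osubtle_of {δ : Ordinal.{u}} (h : Subtle δ.toZFSet) : OSubtle δ := by
  intro d hd C hC
  have hclub : ZClub (Ordinal.toZFSet '' C) δ.toZFSet := by
    refine ⟨?_, ?_, ?_⟩
    · rintro _ ⟨γ, hγ, rfl⟩
      exact Ordinal.toZFSet_mem_toZFSet_iff.2 (hC.1 γ hγ)
    · intro x hx
      obtain ⟨β, hβ, rfl⟩ := Ordinal.mem_toZFSet_iff.1 hx
      obtain ⟨γ, h1, h2⟩ := hC.2.1 β hβ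
      exact ⟨_, ⟨γ, h1, rfl⟩, Ordinal.toZFSet_mem_toZFSet_iff.2 h2⟩
    · intro x hx hne hlim
      obtain ⟨β, hβ, rfl⟩ := Ordinal.mem_toZFSet_iff.1 hx
      refine ⟨β, hC.2.2 β hβ ?_ ?_, rfl⟩
      · obtain ⟨y, hy⟩ := hne
        obtain ⟨γ, hγ, -⟩ := Ordinal.mem_toZFSet_iff.1 hy
        exact zero_le.trans_lt hγ
      · intro γ hγ
        obtain ⟨_, ⟨ε, hε, rfl⟩, h1, h2⟩ := hlim _ (Ordinal.toZFSet_mem_toZFSet_iff.2 hγ)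
        exact ⟨ε, hε, Ordinal.toZFSet_mem_toZFSet_iff.1 h1, Ordinal.toZFSet_mem_toZFSet_iff.1 h2⟩
  obtain ⟨_, _, ⟨α, hα, rfl⟩, ⟨β, hβ, rfl⟩, hαβ, he⟩ := h.2
    (fun x => ZFSet.sep (fun y => y.rank ∈ d x.rank) x)
    (fun x _ y hy => (ZFSet.mem_sep.1 hy).1) _ hclub
  have hαβ' := Ordinal.toZFSet_mem_toZFSet_iff.1 hαβ
  refine ⟨α, hα, β, hβ, hαβ', ?_⟩
  ext ξ
  have := ZFSet.ext_iff.1 he ξ.toZFSet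
  simp only [ZFSet.mem_sep, ZFSet.mem_inter, Ordinal.toZFSet_mem_toZFSet_iff,
    Ordinal.rank_toZFSet] at this
  constructor
  · intro h1
    have h2 : ξ < α := hd α (hC.1 α hα) h1
    exact ⟨(this.1 ⟨h2, h1⟩).1.2, h2⟩
  · rintro ⟨h1, h2⟩
    have h2 : ξ < α := h2
    exact (this.2 ⟨⟨h2.trans hαβ', h1⟩, h2⟩).2

/-- `θ, z` witness that `β` is not hyper-shrewd. -/
def Bad (δ β θ z : ZFSet.{u}) : Prop :=
  ZCard θ ∧ δ ∈ θ ∧ z ∈ HSet θ ∧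
      ¬ ∃ (κ' θ' : ZFSet.{u}) (X : Set ZFSet.{u}) (j : ZFSet.{u} → ZFSet.{u}),
        ZCard κ' ∧ ZCard θ' ∧ κ' ∈ β ∧ δ ∈ θ' ∧
        ElemSub ∅ X (HSet θ') ∧ ElemEmbOn ∅ X (HSet θ) j ∧
        (∀ β ∈ κ', β ∈ X) ∧ κ' ∈ X ∧ δ ∈ X ∧
        (∀ β ∈ κ', j β = β) ∧ j κ' = β ∧ j δ = δ ∧ ∃ x ∈ X, j x = z

theorem exists_bad {δ β : ZFSet.{u}} (h : ¬ HyperShrewd β δ) : ∃ θ z, Bad δ β θ z := by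
  by_contra! hcon
  apply h
  refine ⟨∅, ⟨⟨ZFSet.isTransitive_empty, fun y hy => absurd hy (ZFSet.notMem_empty y)⟩,
    fun y hy => absurd hy (ZFSet.notMem_empty y)⟩, ?_⟩
  intro θ h1 h2 _ z hz
  by_contra hn
  exact hcon θ z ⟨h1, h2, hz, hn⟩

/-- The range of an enumeration. -/
def ERange (β : Ordinal.{u}) (x : ℕ → Ordinal.{u} → ZFSet.{u}) : Set ZFSet.{u} :=
  {y | ∃ n, ∃ ξ < β, x n ξ = y}

def Enumer (δ : ZFSet.{u}) (β : Ordinal.{u}) (θ z : ZFSet.{u}) (x : ℕ → Ordinal.{u} → ZFSet.{u}) :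
    Prop :=
  (∀ ξ < β, x 0 ξ = ξ.toZFSet) ∧ x 1 0 = β.toZFSet ∧ x 2 0 = δ ∧ x 3 0 = z ∧
    ElemSub ∅ (ERange β x) (HSet θ)

theorem exists_enumer {δ : ZFSet.{u}} {β : Ordinal.{u}} {θ z : ZFSet.{u}} (hβ : Ordinal.omega0 < β)
    (hθ : ZCard θ) (hδ : δ ∈ θ) (hβδ : β.toZFSet ∈ δ) (hz : z ∈ HSet θ) :
    ∃ x, Enumer δ β θ z x := by
  classical
  have hβθ : β.toZFSet ∈ θ := hθ.1.1 δ hδ hβδ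
  have h0 : 0 < β := zero_le.trans_lt hβ
  let A : Set ZFSet.{u} := (Ordinal.toZFSet '' Set.Iio β) ∪ {β.toZFSet, δ, z}
  have hc : ℵ₀ ≤ #(Set.Iio β) := by
    rw [Cardinal.mk_Iio_ordinal, Cardinal.aleph0_le_lift, ← Ordinal.card_omega0]
    exact Ordinal.card_le_card hβ.le
  obtain ⟨X, hAX, hXc, hX⟩ := exists_elemSub (HSet θ) A β.toZFSet (Or.inr (Or.inl rfl)) (by
      rintro x (⟨ξ, hξ, rfl⟩ | rfl | rfl | rfl)
      · exact mem_HSet_of hθ (hθ.1.1 _ hβθ (Ordinal.toZFSet_mem_toZFSet_iff.2 hξ))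
      · exact mem_HSet_of hθ hβθ
      · exact mem_HSet_of hθ hδ
      · exact hz) #(Set.Iio β) hc (by
      refine (Cardinal.mk_union_le _ _).trans (Cardinal.add_le_of_le hc Cardinal.mk_image_le ?_)
      refine le_trans ?_ hc
      exact (Set.Finite.lt_aleph0 (by simp)).le)
  obtain ⟨e⟩ := hXc
  have hβX : β.toZFSet ∈ X := hAX (Or.inr (Or.inl rfl))
  have hδX : δ ∈ X := hAX (Or.inr (Or.inr (Or.inl rfl)))
  have hzX : z ∈ X := hAX (Or.inr (Or.inr (Or.inr rfl)))
  haveI : Nonempty X := ⟨⟨_, hβX⟩⟩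
  let g : Ordinal.{u} → ZFSet.{u} := fun ξ =>
    if h : ξ < β then (Function.invFun e ⟨ξ, h⟩ : X).1 else ∅
  let x : ℕ → Ordinal.{u} → ZFSet.{u} := fun n ξ =>
    match n with
    | 0 => ξ.toZFSet
    | 1 => β.toZFSet
    | 2 => δ
    | 3 => z
    | _ => g ξ
  have hran : ERange β x = X := by
    ext y
    constructor
    · rintro ⟨n, ξ, hξ, rfl⟩
      match n with
      | 0 => exact hAX (Or.inl ⟨ξ, hξ, rfl⟩)
      | 1 => exact hβX
      | 2 => exact hδX
      | 3 => exact hzX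
      | n + 4 =>
        show g ξ ∈ X
        simp only [g, hξ, dite_true]
        exact Subtype.property _
    · intro hy
      refine ⟨4, (e ⟨y, hy⟩).1, (e ⟨y, hy⟩).2, ?_⟩
      show g _ = y
      have : (e ⟨y, hy⟩).1 < β := (e ⟨y, hy⟩).2
      simp only [g, this, dite_true]
      have h2 := Function.leftInverse_invFun e.injective ⟨y, hy⟩
      exact congrArg Subtype.val h2
  refine ⟨x, fun ξ _ => rfl, rfl, rfl, rfl, ?_⟩
  rw [hran]
  exact hX

/-- valuation attached to a list of indices -/
noncomputable def lval (x : ℕ → Ordinal.{u} → ZFSet.{u}) (l : List (ℕ × Ordinal.{u})) : ℕ → ZFSet.{u} :=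
  fun n => x (l.getD n (0, 0)).1 (l.getD n (0, 0)).2

/-- The elementary embedding obtained from coherence. -/
theorem embedding {δ : ZFSet.{u}} {α β : Ordinal.{u}} {θ z θ' z' : ZFSet.{u}}
    {x y : ℕ → Ordinal.{u} → ZFSet.{u}} (hαβ : α < β) (h0 : 0 < α)
    (hx : Enumer δ α θ z x) (hy : Enumer δ β θ' z' y) (hα : ZCard α.toZFSet) (hθ : ZCard θ)
    (hδθ : δ ∈ θ)
    (hcoh : ∀ φ l, (∀ p ∈ l, p.2 < α) →
      (SatIn ∅ (HSet θ) φ (lval x l) ↔ SatIn ∅ (HSet θ') φ (lval y l))) :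
    ¬ Bad δ β.toZFSet θ' z' := by
  classical
  rintro ⟨-, -, -, hno⟩
  apply hno
  -- coherence for arbitrary valuations
  have hcoh' : ∀ (φ : SF) (i : ℕ → ℕ × Ordinal.{u}), (∀ n, (i n).2 < α) →
      (SatIn ∅ (HSet θ) φ (fun n => x (i n).1 (i n).2) ↔
        SatIn ∅ (HSet θ') φ (fun n => y (i n).1 (i n).2)) := by
    intro φ i hi
    obtain ⟨N, hN⟩ := sat_local.{u} φ
    have hget : ∀ n < N, ((List.range N).map i).getD n (0, 0) = i n := by
      intro n hn
      rw [List.getD_eq_getElem _ _ (by simpa using hn)]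
      simp
    have h1 : SatIn ∅ (HSet θ) φ (fun n => x (i n).1 (i n).2) ↔
        SatIn ∅ (HSet θ) φ (lval x ((List.range N).map i)) := by
      apply hN
      intro n hn
      simp only [lval]
      rw [hget n hn]
    have h2 : SatIn ∅ (HSet θ') φ (fun n => y (i n).1 (i n).2) ↔
        SatIn ∅ (HSet θ') φ (lval y ((List.range N).map i)) := by
      apply hN
      intro n hn
      simp only [lval]
      rw [hget n hn]
    rw [h1, h2]
    apply hcoh
    intro p hp
    obtain ⟨n, -, rfl⟩ := List.mem_map.1 hp
    exact hi n
  have hex : ∀ a, ∃ p : ℕ × Ordinal.{u}, a ∈ ERange α x → p.2 < α ∧ x p.1 p.2 = a := by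
    intro a
    by_cases h : a ∈ ERange α x
    · obtain ⟨n, ξ, hξ, h1⟩ := h
      exact ⟨(n, ξ), fun _ => ⟨hξ, h1⟩⟩
    · exact ⟨(0, 0), fun h' => absurd h' h⟩
  choose I hI using hex
  let j : ZFSet.{u} → ZFSet.{u} := fun a => y (I a).1 (I a).2
  have hj : ∀ n, ∀ ξ < α, j (x n ξ) = y n ξ := by
    intro n ξ hξ
    have h1 := hI (x n ξ) ⟨n, ξ, hξ, rfl⟩
    have h2 := hcoh' (.eq 0 1) (fun k => if k = 0 then I (x n ξ) else (n, ξ)) (by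
      intro k
      by_cases hk : k = 0
      · simp only [hk, if_true]; exact h1.1
      · simp only [hk, if_false]; exact hξ)
    simp only [SatIn, Sat] at h2
    exact h2.1 h1.2
  have hxsub := hx.2.2.2.2.1
  have hysub := hy.2.2.2.2.1
  refine ⟨α.toZFSet, θ, ERange α x, j, hα, hθ, Ordinal.toZFSet_mem_toZFSet_iff.2 hαβ, hδθ,
    hx.2.2.2.2, ⟨?_, ?_⟩, ?_, ⟨1, 0, h0, hx.2.1⟩, ⟨2, 0, h0, hx.2.2.1⟩, ?_, ?_, ?_, ?_⟩
  · intro a ha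
    exact hysub ⟨_, _, (hI a ha).1.trans hαβ, rfl⟩
  · intro φ v hv
    rw [hx.2.2.2.2.2 φ v hv]
    have h1 := hcoh' φ (fun n => I (v n)) (fun n => (hI _ (hv n)).1)
    have h2 : (fun n => x (I (v n)).1 (I (v n)).2) = v := by
      funext n
      exact (hI _ (hv n)).2
    rw [h2] at h1
    exact h1
  · intro b hb
    obtain ⟨ξ, hξ, rfl⟩ := Ordinal.mem_toZFSet_iff.1 hb
    exact ⟨0, ξ, hξ, hx.1 ξ hξ⟩
  · intro b hb
    obtain ⟨ξ, hξ, rfl⟩ := Ordinal.mem_toZFSet_iff.1 hb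
    have := hj 0 ξ hξ
    rwa [hx.1 ξ hξ, hy.1 ξ (hξ.trans hαβ)] at this
  · have := hj 1 0 h0
    rwa [hx.2.1, hy.2.1] at this
  · have := hj 2 0 h0
    rwa [hx.2.2.1, hy.2.2.1] at this
  · refine ⟨x 3 0, ⟨3, 0, h0, rfl⟩, ?_⟩
    rw [hj 3 0 h0, hy.2.2.2.1]

/-- The coded information attached to `β`. -/
def CodeFor (δ : ZFSet.{u}) (β : Ordinal.{u}) (D : Set (SF × List (ℕ × Ordinal.{u}))) : Prop :=
  (∃ l < β, ∃ f : Ordinal.{u} → Ordinal.{u}, (∀ ξ < l, f ξ < β) ∧ (∀ γ < β, ∃ ξ < l, γ ≤ f ξ) ∧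
    D = {k | k = (SF.pred 0, [(0, l)]) ∨ ∃ ξ < l, k = (SF.pred 1, [(0, ξ), (0, f ξ)])}) ∨
  (∃ θ z x, Bad δ β.toZFSet θ z ∧ Enumer δ β θ z x ∧
    D = {k | SatIn ∅ (HSet θ) k.1 (lval x k.2)})

/-- If `δ` is a subtle cardinal, then the set of inaccessible `δ`-hyper-shrewd
cardinals below `δ` is stationary in `δ`. -/
theorem subtle_stationary_hyperShrewd (δ : ZFSet.{u}) (h : Subtle δ) :
    ZStationary {κ : ZFSet.{u} | κ ∈ δ ∧ Inacc κ ∧ HyperShrewd κ δ} δ := by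
  intro C hC
  by_contra hcon
  have hδord : δ.rank.toZFSet = δ := ((zord_iff δ).1 h.1.1).toZFSet_rank_eq
  generalize hδ' : δ.rank = δ' at hδord
  subst hδord
  clear hδ'
  have hO := osubtle_of h
  -- basic facts on `δ'`
  have hl : ∀ β < δ', Order.succ β < δ' := by
    intro β hβ
    obtain ⟨γ, hγ, hβγ⟩ := hC.2.1 _ (Ordinal.toZFSet_mem_toZFSet_iff.2 hβ)
    obtain ⟨γ', hγ', rfl⟩ := Ordinal.mem_toZFSet_iff.1 (hC.1 γ hγ)
    exact (Order.succ_le_of_lt (Ordinal.toZFSet_mem_toZFSet_iff.1 hβγ)).trans_lt hγ'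
  have h0 : 0 < δ' := by
    obtain ⟨α, β, hα, -, -, -⟩ := h.2 (fun _ => ∅) (fun α _ => ZFSet.empty_subset α) C hC
    obtain ⟨γ', hγ', -⟩ := Ordinal.mem_toZFSet_iff.1 (hC.1 α hα)
    exact zero_le.trans_lt hγ'
  have hcard : δ'.card.ord = δ' := by
    refine le_antisymm (Cardinal.ord_card_le _) ?_
    by_contra! hlt
    have := h.1.2 _ (Ordinal.toZFSet_mem_toZFSet_iff.2 hlt)
    rw [mk_toSet_ord, mk_toSet_ord, Cardinal.card_ord] at this
    exact lt_irrefl _ this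
  let C' : Set Ordinal.{u} := {o | o.toZFSet ∈ C}
  have hC' : OClub C' δ' := by
    refine ⟨fun γ hγ => Ordinal.toZFSet_mem_toZFSet_iff.1 (hC.1 _ hγ), ?_, ?_⟩
    · intro β hβ
      obtain ⟨γ, hγ, hβγ⟩ := hC.2.1 _ (Ordinal.toZFSet_mem_toZFSet_iff.2 hβ)
      obtain ⟨γ', hγ', rfl⟩ := Ordinal.mem_toZFSet_iff.1 (hC.1 γ hγ)
      exact ⟨γ', hγ, Ordinal.toZFSet_mem_toZFSet_iff.1 hβγ⟩
    · intro β hβ hpos hlim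
      refine hC.2.2 _ (Ordinal.toZFSet_mem_toZFSet_iff.2 hβ)
        ⟨_, Ordinal.toZFSet_mem_toZFSet_iff.2 hpos⟩ ?_
      intro x hx
      obtain ⟨γ, hγ, rfl⟩ := Ordinal.mem_toZFSet_iff.1 hx
      obtain ⟨ε, h1, h2, h3⟩ := hlim γ hγ
      exact ⟨_, h1, Ordinal.toZFSet_mem_toZFSet_iff.2 h2, Ordinal.toZFSet_mem_toZFSet_iff.2 h3⟩
  have hD : ∀ β : Ordinal.{u}, ∃ D, β ∈ C' → Ordinal.omega0 < β →
      (∀ ξ < β, ((2 : Cardinal.{u}) ^ ξ.card).ord < β) → CodeFor δ'.toZFSet β D := by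
    intro β
    by_cases hβ : β ∈ C' ∧ Ordinal.omega0 < β ∧
      (∀ ξ < β, ((2 : Cardinal.{u}) ^ ξ.card).ord < β)
    swap
    · exact ⟨∅, fun h1 h2 h3 => absurd ⟨h1, h2, h3⟩ hβ⟩
    obtain ⟨hβC, hβω, hβl⟩ := hβ
    by_cases hs : OSing β
    · obtain ⟨l, hl, f, hf, hf'⟩ := hs
      exact ⟨_, fun _ _ _ => Or.inl ⟨l, hl, f, hf, hf', rfl⟩⟩
    · have hin := inacc_of hβl hβω hs
      have hnot : ¬ HyperShrewd β.toZFSet δ'.toZFSet := fun hh =>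
        hcon ⟨_, hβC, hC.1 _ hβC, hin, hh⟩
      obtain ⟨θ, z, hbad⟩ := exists_bad hnot
      obtain ⟨x, hx⟩ := exists_enumer hβω hbad.1 hbad.2.1 (hC.1 _ hβC) hbad.2.2.1
      exact ⟨_, fun _ _ _ => Or.inr ⟨θ, z, x, hbad, hx, rfl⟩⟩
  choose D hD using hD
  obtain ⟨α, hαC, β, hβC, hαβ, hαω, hα, hβ, hcoh⟩ := coded_subtle h0 hl hcard hO C' hC' D
  have hα0 : 0 < α := zero_le.trans_lt hαω
  rcases hD α hαC hαω hα with ⟨l, hl1, f, hf, hf', hDα⟩ | ⟨θ, z, x, hbad, hx, hDα⟩ <;>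
  rcases hD β hβC (hαω.trans hαβ) hβ with ⟨l', hl1', g, hg, hg', hDβ⟩ | ⟨θ', z', y, hbad', hy, hDβ⟩
  · have e1 : l = l' := by
      have := (hcoh (SF.pred 0) [(0, l)] (by simpa using hl1)).1 (by rw [hDα]; exact Or.inl rfl)
      rw [hDβ] at this
      rcases this with this | ⟨ξ, -, this⟩
      · simpa using this
      · simp at this
    subst e1
    obtain ⟨ξ, hξ, hle⟩ := hg' α hαβ
    have := (hcoh (SF.pred 1) [(0, ξ), (0, f ξ)] (by
      intro p hp
      simp only [List.mem_cons, List.not_mem_nil, or_false] at hp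
      rcases hp with rfl | rfl
      · exact hξ.trans hl1
      · exact hf ξ hξ)).1 (by rw [hDα]; exact Or.inr ⟨ξ, hξ, rfl⟩)
    rw [hDβ] at this
    rcases this with this | ⟨η, -, this⟩
    · simp at this
    · simp only [Prod.mk.injEq, List.cons.injEq, true_and, and_true] at this
      rw [← this.1] at this
      exact absurd (hf ξ hξ) (not_lt.2 (this.2 ▸ hle))
  · have := (hcoh (SF.pred 0) [(0, l)] (by simpa using hl1)).1 (by rw [hDα]; exact Or.inl rfl)
    rw [hDβ] at this
    exact this
  · have := (hcoh (SF.eq 0 0) [] (by simp)).1 (by rw [hDα]; exact rfl)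
    rw [hDβ] at this
    rcases this with this | ⟨ξ, -, this⟩
    · simp at this
    · simp at this
  · refine embedding hαβ hα0 hx hy (zcard_of hα) hbad.1 hbad.2.1 ?_ hbad'
    intro φ l hlα
    have := hcoh φ l hlα
    rw [hDα, hDβ] at this
    exact this
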